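/- Let ω ∈ W_0 satisfy (ω_1) and (ω_5) and γ((ω⋆)^ι) > 0. Then for every γ with 0 < γ < min(2, γ((ω⋆)^ι)) there exist constants K₁, K₂, K₃ > 0 depending only on ω and γ such that for every a > 0 there exist y > 0 and a holomorphic function G_a on the sector S_γ satisfying: (1) for all ξ ∈ S_γ, K₁^{−a} exp(−2a ω⋆(K₂|ξ|)) ≤ |G_a(ξ)| ≤ exp(−(a/2) ω⋆(K₃|ξ|)); and (2) there is h > 0 with sup_{ξ∈S_γ, j∈ℕ} |G_a^{(j)}(ξ)| / (h^j W^y_j) < ∞. -/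

import Mathlib

open Filter MeasureTheory Set Asymptotics

noncomputable section

/-- A *weight function*: continuous and nondecreasing on `[0,∞)`, vanishing at `0`,
and tending to `+∞` at `+∞`. -/
structure IsWeightFunction (ω : ℝ → ℝ) : Prop where
  continuousOn : ContinuousOn ω (Set.Ici 0)
  monotoneOn : MonotoneOn ω (Set.Ici 0)
  map_zero : ω 0 = 0
  tendsto_atTop : Filter.Tendsto ω Filter.atTop Filter.atTop

/-- Condition `(P_{ω,γ})`: there is `K > 1` with `limsup_{t→∞} ω(K^γ t)/ω(t) < K`,
expressed through an eventual bound by some `c < K`. -/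
def Pcond (ω : ℝ → ℝ) (γ : ℝ) : Prop :=
  ∃ K : ℝ, 1 < K ∧ ∃ c : ℝ, c < K ∧ ∀ᶠ t : ℝ in Filter.atTop, ω (K ^ γ * t) / ω t ≤ c

/-- The growth index `γ(ω) ∈ [0,+∞]`, with `sup ∅ = 0`. -/
noncomputable def gammaIndex (ω : ℝ → ℝ) : ENNReal :=
  ⨆ γ ∈ {γ : ℝ | 0 < γ ∧ Pcond ω γ}, ENNReal.ofReal γ

/-- Condition `(ω₁)`. -/
def Omega1 (ω : ℝ → ℝ) : Prop :=
  ∃ L : ℝ, 1 ≤ L ∧ ∀ t : ℝ, 0 ≤ t → ω (2 * t) ≤ L * (ω t + 1)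

/-- Condition `(ω₃)`: `log t = o(ω t)` as `t → ∞`. -/
def Omega3 (ω : ℝ → ℝ) : Prop :=
  (fun t : ℝ => Real.log t) =o[Filter.atTop] ω

/-- Condition `(ω₄)`: `t ↦ ω (exp t)` is convex on `ℝ`. -/
def Omega4 (ω : ℝ → ℝ) : Prop :=
  ConvexOn ℝ Set.univ (fun t : ℝ => ω (Real.exp t))

/-- Condition `(ω₅)`: `ω t = o(t)` as `t → ∞`. -/
def Omega5 (ω : ℝ → ℝ) : Prop :=
  ω =o[Filter.atTop] (fun t : ℝ => t)

/-- Condition `(ω_snq)`. -/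
def OmegaSnq (ω : ℝ → ℝ) : Prop :=
  ∃ C : ℝ, 0 < C ∧ ∀ y : ℝ, 0 < y →
    (∫⁻ t in Set.Ioi (1:ℝ), ENNReal.ofReal (ω (y * t) / t ^ 2)) ≤
      ENNReal.ofReal (C * (ω y + 1))

/-- `ω ∈ W₀`: normalized weight function with `(ω₃)` and `(ω₄)`. -/
def InW0 (ω : ℝ → ℝ) : Prop :=
  IsWeightFunction ω ∧ (∀ t ∈ Set.Icc (0:ℝ) 1, ω t = 0) ∧ Omega3 ω ∧ Omega4 ω

/-- The Legendre–Fenchel–Young conjugate `φ*_ω(x) = sup {x y − ω(e^y) : y ≥ 0}`. -/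
noncomputable def phiStar (ω : ℝ → ℝ) (x : ℝ) : ℝ :=
  sSup ((fun y : ℝ => x * y - ω (Real.exp y)) '' Set.Ici 0)

/-- The associated weight matrix `W^l_j = exp((1/l) φ*_ω(l j))`. -/
noncomputable def Wseq (ω : ℝ → ℝ) (l : ℝ) (j : ℕ) : ℝ :=
  Real.exp ((1 / l) * phiStar ω (l * (j : ℝ)))

/-- `w^l_j = W^l_j / j!`. -/
noncomputable def wseq (ω : ℝ → ℝ) (l : ℝ) (j : ℕ) : ℝ :=
  Wseq ω l j / (Nat.factorial j : ℝ)

/-- `h_M(t) = inf_{k ∈ ℕ} M_k t^k`. -/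
noncomputable def hFun (M : ℕ → ℝ) (t : ℝ) : ℝ :=
  ⨅ k : ℕ, M k * t ^ k

/-- The associated function `ω_M(t) = sup_p log (t^p / M_p)` for `t > 0`, `ω_M(0) = 0`. -/
noncomputable def assocWeight (M : ℕ → ℝ) (t : ℝ) : ℝ :=
  if t ≤ 0 then 0 else ⨆ p : ℕ, Real.log (t ^ p / M p)

/-- The upper Legendre conjugate `ω⋆(s) = sup_{t ≥ 0} (ω(t) − s t)`. -/
noncomputable def upperConj (ω : ℝ → ℝ) (s : ℝ) : ℝ :=
  sSup ((fun t : ℝ => ω t - s * t) '' Set.Ici 0)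

/-- `(ω⋆)^ι(t) = ω⋆(1/t)` for `t > 0`, with value `0` at `t = 0`. -/
noncomputable def upperConjIota (ω : ℝ → ℝ) (t : ℝ) : ℝ :=
  if t = 0 then 0 else upperConj ω (1 / t)

/-- The lower Legendre conjugate `(ω^ι)_⋆(t) = inf_{s > 0} (ω(1/s) + t s)`. -/
noncomputable def lowerConjIota (ω : ℝ → ℝ) (t : ℝ) : ℝ :=
  sInf ((fun s : ℝ => ω (1 / s) + t * s) '' Set.Ioi 0)

/-- The unbounded sector `S_γ ⊆ ℂ` of opening `γ π` bisected by direction `0`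
(for `0 < γ < 2` it lies in `ℂ`). -/
def sector (γ : ℝ) : Set ℂ :=
  {z : ℂ | z ≠ 0 ∧ |Complex.arg z| < γ * Real.pi / 2}

/-- `M ∈ LC`: positive, normalized, log-convex, `(M_p)^{1/p} → ∞`. -/
def LCseq (M : ℕ → ℝ) : Prop :=
  (∀ p, 0 < M p) ∧ M 0 = 1 ∧ M 0 ≤ M 1 ∧
  (∀ j : ℕ, 1 ≤ j → M j ^ 2 ≤ M (j - 1) * M (j + 1)) ∧
  Filter.Tendsto (fun p : ℕ => M p ^ ((1 : ℝ) / (p : ℝ))) Filter.atTop Filter.atTop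

/-- The partial derivative `∂_i` of a function on `ℝ^d`. -/
noncomputable def partialDeriv {d : ℕ} (i : Fin d)
    (f : EuclideanSpace ℝ (Fin d) → ℂ) : EuclideanSpace ℝ (Fin d) → ℂ :=
  fun x => fderiv ℝ f x (EuclideanSpace.single i 1)

/-- The iterated partial derivative `∂^j` for a multiindex `j ∈ ℕ^d`. -/
noncomputable def multiDeriv {d : ℕ} (j : Fin d → ℕ)
    (f : EuclideanSpace ℝ (Fin d) → ℂ) : EuclideanSpace ℝ (Fin d) → ℂ :=
  (List.finRange d).foldr (fun i g => (partialDeriv i)^[j i] g) f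

end

/-- The supremum defining `ω⋆ s` is finite for `s > 0` when `ω t = o(t)`. -/
lemma bddAbove_upperConj {ω : ℝ → ℝ} (hω : IsWeightFunction ω) (h5 : Omega5 ω) {s : ℝ}
    (hs : 0 < s) : BddAbove ((fun t : ℝ => ω t - s * t) '' Set.Ici 0) := by
  have h := h5.bound hs
  obtain ⟨T, hT⟩ := (h.and (eventually_ge_atTop 0)).exists_forall_of_atTop
  have hT0 : 0 ≤ T := (hT T le_rfl).2
  have hωT : 0 ≤ ω T := hω.map_zero ▸ hω.monotoneOn (Set.mem_Ici.2 le_rfl) hT0 hT0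
  refine ⟨ω T, ?_⟩
  rintro _ ⟨t, ht, rfl⟩
  have ht0 : 0 ≤ t := ht
  have hst : 0 ≤ s * t := by positivity
  simp only
  rcases le_total t T with h' | h'
  · linarith [hω.monotoneOn ht hT0 h']
  · have h2 := (hT t h').1
    rw [Real.norm_eq_abs, Real.norm_eq_abs, abs_of_nonneg ht0] at h2
    linarith [le_abs_self (ω t)]

lemma le_upperConj {ω : ℝ → ℝ} (hω : IsWeightFunction ω) (h5 : Omega5 ω) {s t : ℝ}
    (hs : 0 < s) (ht : 0 ≤ t) : ω t - s * t ≤ upperConj ω s :=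
  le_csSup (bddAbove_upperConj hω h5 hs) ⟨t, ht, rfl⟩

lemma upperConj_le {ω : ℝ → ℝ} {s C : ℝ} (h : ∀ t, 0 ≤ t → ω t - s * t ≤ C) :
    upperConj ω s ≤ C :=
  csSup_le (Set.nonempty_Ici.image _) (by rintro _ ⟨t, ht, rfl⟩; exact h t ht)

lemma upperConj_nonneg {ω : ℝ → ℝ} (hω : IsWeightFunction ω) (h5 : Omega5 ω) {s : ℝ}
    (hs : 0 < s) : 0 ≤ upperConj ω s := by
  simpa [hω.map_zero] using le_upperConj hω h5 hs le_rfl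

lemma upperConj_anti {ω : ℝ → ℝ} (hω : IsWeightFunction ω) (h5 : Omega5 ω) {s r : ℝ}
    (hs : 0 < s) (hsr : s ≤ r) : upperConj ω r ≤ upperConj ω s := by
  refine upperConj_le fun t ht => le_trans ?_ (le_upperConj hω h5 hs ht)
  have := mul_le_mul_of_nonneg_right hsr ht
  linarith

/-- `ω⋆` vanishes at some point, hence on a half-line. -/
lemma exists_upperConj_eq_zero {ω : ℝ → ℝ} (hω : InW0 ω) (h5 : Omega5 ω) :
    ∃ q : ℝ, 0 < q ∧ upperConj ω q = 0 := by
  obtain ⟨hw, hn, -, -⟩ := hω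
  obtain ⟨T, hT⟩ := ((h5.bound one_pos).and (eventually_ge_atTop 0)).exists_forall_of_atTop
  have hT0 : 0 ≤ T := (hT T le_rfl).2
  have hωT : 0 ≤ ω T := hw.map_zero ▸ hw.monotoneOn (Set.mem_Ici.2 le_rfl) hT0 hT0
  have hq : 0 < ω T + 1 := by linarith
  refine ⟨ω T + 1, hq, le_antisymm (upperConj_le fun t ht => ?_) (upperConj_nonneg hw h5 hq)⟩
  rcases le_total t 1 with h1 | h1
  · rw [hn t ⟨ht, h1⟩]
    nlinarith
  rcases le_total t T with h' | h'
  · nlinarith [hw.monotoneOn ht hT0 h']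
  · have h2 := (hT t h').1
    rw [Real.norm_eq_abs, Real.norm_eq_abs, abs_of_nonneg ht, one_mul] at h2
    nlinarith [le_abs_self (ω t)]

lemma eventually_upperConjIota_pos {ω : ℝ → ℝ} (hω : IsWeightFunction ω) (h5 : Omega5 ω) :
    ∀ᶠ t : ℝ in atTop, 0 < upperConjIota ω t := by
  obtain ⟨T, hT⟩ := ((hω.tendsto_atTop.eventually_gt_atTop 1).and
    (eventually_gt_atTop 0)).exists
  filter_upwards [eventually_gt_atTop T] with t ht
  have ht0 : 0 < t := hT.2.trans ht
  rw [upperConjIota, if_neg ht0.ne']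
  refine lt_of_lt_of_le ?_ (le_upperConj hω h5 (by positivity : (0 : ℝ) < 1 / t) hT.2.le)
  have : 1 / t * T < 1 := by
    rw [one_div, inv_mul_lt_iff₀ ht0]
    linarith
  linarith [hT.1]

/-- Elements below the Legendre conjugate defining the weight matrix. -/
lemma pow_mul_exp_le_Wseq {ω : ℝ → ℝ} (hω : InW0 ω) {y t : ℝ} (hy : 0 < y) (ht : 1 ≤ t)
    (j : ℕ) : t ^ j * Real.exp (-(ω t / y)) ≤ Wseq ω y j := by
  obtain ⟨hw, -, h3, -⟩ := hω
  have ht0 : 0 < t := by linarith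
  have hnn : ∀ u, 0 ≤ u → 0 ≤ ω u := fun u hu =>
    hw.map_zero ▸ hw.monotoneOn (Set.mem_Ici.2 le_rfl) hu hu
  have hbdd : BddAbove ((fun u : ℝ => y * (j : ℝ) * u - ω (Real.exp u)) '' Set.Ici 0) := by
    have hc : (0 : ℝ) < 1 / (y * j + 1) := by positivity
    obtain ⟨T, hT⟩ := (((h3.bound hc).and (eventually_ge_atTop 1))).exists_forall_of_atTop
    have hT1 : 1 ≤ T := (hT T le_rfl).2
    refine ⟨y * j * Real.log T, ?_⟩
    rintro _ ⟨u, hu, rfl⟩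
    have hu0 : 0 ≤ u := hu
    simp only
    rcases le_total u (Real.log T) with h' | h'
    · have := mul_le_mul_of_nonneg_left h' (by positivity : 0 ≤ y * (j : ℝ))
      linarith [hnn _ (Real.exp_pos u).le]
    · have h2 := (hT (Real.exp u) ((Real.log_le_iff_le_exp (by linarith)).1 h')).1
      rw [Real.log_exp, Real.norm_eq_abs, Real.norm_eq_abs, abs_of_nonneg hu0,
        abs_of_nonneg (hnn _ (Real.exp_pos u).le), one_div, inv_mul_eq_div,
        le_div_iff₀ (by positivity)] at h2
      have : 0 ≤ y * j * Real.log T := by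
        have := Real.log_nonneg hT1
        positivity
      linarith
  have h := le_csSup hbdd ⟨Real.log t, Real.log_nonneg ht, rfl⟩
  simp only [Real.exp_log ht0] at h
  rw [Wseq]
  calc t ^ j * Real.exp (-(ω t / y))
      = Real.exp (1 / y * (y * j * Real.log t - ω t)) := by
        rw [← Real.exp_log (pow_pos ht0 j), ← Real.exp_add, Real.log_pow]
        congr 1
        field_simp
        ring
    _ ≤ _ := by
        apply Real.exp_le_exp.2
        exact mul_le_mul_of_nonneg_left h (by positivity)

/-- The function `∑ (s_{n+1} - s_n) w / (w + K^n)`, whose real part on the right half-plane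
is comparable to the step function counting `s`. -/
noncomputable def stepSeries (s : ℕ → ℝ) (K : ℝ) (w : ℂ) : ℂ :=
  ∑' n : ℕ, ((s (n + 1) - s n : ℝ) : ℂ) * (w / (w + ((K ^ n : ℝ) : ℂ)))

lemma le_norm_add_ofReal {w : ℂ} (hw : 0 < w.re) {x : ℝ} :
    x ≤ ‖w + (x : ℂ)‖ := by
  have := Complex.re_le_norm (w + x)
  simp at this
  linarith

lemma norm_div_add_ofReal_le {w : ℂ} (hw : 0 < w.re) {x : ℝ} (hx : 0 < x) :
    ‖w / (w + (x : ℂ))‖ ≤ ‖w‖ / x := by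
  rw [norm_div]
  gcongr
  exact le_norm_add_ofReal hw

lemma re_div_add_ofReal {w : ℂ} {x : ℝ} :
    (w / (w + (x : ℂ))).re = (‖w‖ ^ 2 + x * w.re) / (‖w‖ ^ 2 + 2 * x * w.re + x ^ 2) := by
  have h1 : ‖w‖ ^ 2 = w.re * w.re + w.im * w.im := by
    rw [Complex.sq_norm, Complex.normSq_apply]
  have h2 : Complex.normSq (w + x) = ‖w‖ ^ 2 + 2 * x * w.re + x ^ 2 := by
    rw [h1, Complex.normSq_apply]
    simp
    ring
  rw [Complex.div_re, h2, h1, ← add_div]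
  simp
  ring

lemma re_div_add_ofReal_nonneg {w : ℂ} (hw : 0 < w.re) {x : ℝ} (hx : 0 < x) :
    0 ≤ (w / (w + (x : ℂ))).re := by
  rw [re_div_add_ofReal]
  positivity

lemma re_div_add_ofReal_le_one {w : ℂ} (hw : 0 < w.re) {x : ℝ} (hx : 0 < x) :
    (w / (w + (x : ℂ))).re ≤ 1 := by
  rw [re_div_add_ofReal]
  have : 0 < x * w.re := by positivity
  exact div_le_one_of_le₀ (by nlinarith [sq_nonneg x]) (by positivity)

lemma half_le_re_div_add_ofReal {w : ℂ} (hw : 0 < w.re) {x : ℝ} (hx : 0 < x) (h : x ≤ ‖w‖) :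
    1 / 2 ≤ (w / (w + (x : ℂ))).re := by
  have : 0 < x * w.re := by positivity
  rw [re_div_add_ofReal, le_div_iff₀ (by positivity)]
  nlinarith

section StepSeries

variable {s : ℕ → ℝ} {K c : ℝ} {n₀ : ℕ}

lemma le_pow_mul_of_ratio_le (hc0 : 0 < c) (hr : ∀ n, n₀ ≤ n → s (n + 1) ≤ c * s n)
    {N : ℕ} (hN : n₀ ≤ N) (i : ℕ) : s (N + i) ≤ c ^ i * s N := by
  induction i with
  | zero => simp
  | succ i ih =>
    calc s (N + (i + 1)) ≤ c * s (N + i) := hr (N + i) (by omega)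
      _ ≤ c * (c ^ i * s N) := by gcongr
      _ = _ := by ring

lemma increment_div_pow_le (hs0 : ∀ n, 0 ≤ s n) (hK : 1 < K) (hc0 : 0 < c)
    (hr : ∀ n, n₀ ≤ n → s (n + 1) ≤ c * s n) {N : ℕ} (hN : n₀ ≤ N) (i : ℕ) :
    (s (i + N + 1) - s (i + N)) / K ^ (i + N) ≤ s N * c / K ^ N * (c / K) ^ i := by
  have hK0 : 0 < K := by linarith
  have h := le_pow_mul_of_ratio_le hc0 hr hN (i + 1)
  rw [show i + N + 1 = N + (i + 1) by ring]
  calc (s (N + (i + 1)) - s (i + N)) / K ^ (i + N) ≤ (c ^ (i + 1) * s N) / K ^ (i + N) := by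
        gcongr
        linarith [hs0 (i + N)]
    _ = _ := by
        rw [div_pow, pow_add, pow_succ]
        field_simp
        ring

lemma summable_increment_div_pow (hs : Monotone s) (hs0 : ∀ n, 0 ≤ s n) (hK : 1 < K)
    (hc0 : 0 < c) (hcK : c < K) (hr : ∀ n, n₀ ≤ n → s (n + 1) ≤ c * s n) :
    Summable fun n => (s (n + 1) - s n) / K ^ n := by
  have hK0 : 0 < K := by linarith
  rw [← summable_nat_add_iff n₀]
  refine Summable.of_nonneg_of_le (fun i => ?_)
    (fun i => increment_div_pow_le hs0 hK hc0 hr le_rfl i) ?_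
  · exact div_nonneg (sub_nonneg.2 (hs (Nat.le_succ _))) (by positivity)
  · exact (summable_geometric_of_lt_one (by positivity) ((div_lt_one hK0).2 hcK)).mul_left _

lemma tsum_increment_div_pow_le (hs : Monotone s) (hs0 : ∀ n, 0 ≤ s n) (hK : 1 < K)
    (hc0 : 0 < c) (hcK : c < K) (hr : ∀ n, n₀ ≤ n → s (n + 1) ≤ c * s n) {N : ℕ}
    (hN : n₀ ≤ N) :
    ∑' i, (s (i + N + 1) - s (i + N)) / K ^ (i + N) ≤ s N * c / K ^ N * (1 - c / K)⁻¹ := by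
  have hK0 : 0 < K := by linarith
  have hlt : c / K < 1 := (div_lt_one hK0).2 hcK
  have hgeo := (summable_geometric_of_lt_one (by positivity) hlt).mul_left (s N * c / K ^ N)
  rw [← tsum_geometric_of_lt_one (by positivity) hlt, ← tsum_mul_left]
  exact Summable.tsum_le_tsum (fun i => increment_div_pow_le hs0 hK hc0 hr hN i)
    ((summable_nat_add_iff N).2 (summable_increment_div_pow hs hs0 hK hc0 hcK hr)) hgeo

lemma norm_stepSeries_term_le (hs : Monotone s) (hK : 1 < K) {w : ℂ} (hw : 0 < w.re) (n : ℕ) :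
    ‖((s (n + 1) - s n : ℝ) : ℂ) * (w / (w + ((K ^ n : ℝ) : ℂ)))‖ ≤
      ‖w‖ * ((s (n + 1) - s n) / K ^ n) := by
  have hd : 0 ≤ s (n + 1) - s n := sub_nonneg.2 (hs (Nat.le_succ n))
  have hKn : 0 < K ^ n := pow_pos (by linarith) n
  rw [norm_mul, Complex.norm_real, Real.norm_eq_abs, abs_of_nonneg hd]
  calc _ ≤ (s (n + 1) - s n) * (‖w‖ / K ^ n) := by
        gcongr
        exact norm_div_add_ofReal_le hw hKn
    _ = _ := by ring

lemma hasSum_re_stepSeries (hs : Monotone s) (hs0 : ∀ n, 0 ≤ s n) (hK : 1 < K)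
    (hc0 : 0 < c) (hcK : c < K) (hr : ∀ n, n₀ ≤ n → s (n + 1) ≤ c * s n) {w : ℂ}
    (hw : 0 < w.re) :
    HasSum (fun n => (s (n + 1) - s n) * (w / (w + ((K ^ n : ℝ) : ℂ))).re)
      (stepSeries s K w).re := by
  have hsum : Summable fun n : ℕ =>
      ((s (n + 1) - s n : ℝ) : ℂ) * (w / (w + ((K ^ n : ℝ) : ℂ))) :=
    Summable.of_norm_bounded
      ((summable_increment_div_pow hs hs0 hK hc0 hcK hr).mul_left ‖w‖)
      (norm_stepSeries_term_le hs hK hw)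
  have h := Complex.hasSum_re hsum.hasSum
  simpa only [Complex.re_ofReal_mul, stepSeries] using h

lemma re_stepSeries_nonneg (hs : Monotone s) (hs0 : ∀ n, 0 ≤ s n) (hK : 1 < K)
    (hc0 : 0 < c) (hcK : c < K) (hr : ∀ n, n₀ ≤ n → s (n + 1) ≤ c * s n) {w : ℂ}
    (hw : 0 < w.re) : 0 ≤ (stepSeries s K w).re :=
  (hasSum_re_stepSeries hs hs0 hK hc0 hcK hr hw).nonneg fun n =>
    mul_nonneg (sub_nonneg.2 (hs (Nat.le_succ n)))
      (re_div_add_ofReal_nonneg hw (pow_pos (by linarith) n))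

lemma half_le_re_stepSeries (hs : Monotone s) (hs0 : ∀ n, 0 ≤ s n) (hz : s 0 = 0) (hK : 1 < K)
    (hc0 : 0 < c) (hcK : c < K) (hr : ∀ n, n₀ ≤ n → s (n + 1) ≤ c * s n) {w : ℂ}
    (hw : 0 < w.re) {m : ℕ} (hm : K ^ m ≤ ‖w‖) : s (m + 1) / 2 ≤ (stepSeries s K w).re := by
  have hd : ∀ n, 0 ≤ s (n + 1) - s n := fun n => sub_nonneg.2 (hs (Nat.le_succ n))
  refine le_trans ?_ (sum_le_hasSum (Finset.range (m + 1)) (fun n _ =>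
    mul_nonneg (hd n) (re_div_add_ofReal_nonneg hw (pow_pos (by linarith) n)))
    (hasSum_re_stepSeries hs hs0 hK hc0 hcK hr hw))
  have h : s (m + 1) / 2 = ∑ n ∈ Finset.range (m + 1), (s (n + 1) - s n) * (1 / 2) := by
    rw [← Finset.sum_mul, Finset.sum_range_sub, hz]
    ring
  rw [h]
  refine Finset.sum_le_sum fun n hn => mul_le_mul_of_nonneg_left ?_ (hd n)
  refine half_le_re_div_add_ofReal hw (pow_pos (by linarith) n) (le_trans ?_ hm)
  exact pow_le_pow_right₀ hK.le (Nat.lt_succ_iff.1 (Finset.mem_range.1 hn))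

lemma re_stepSeries_le (hs : Monotone s) (hs0 : ∀ n, 0 ≤ s n) (hz : s 0 = 0) (hK : 1 < K)
    (hc0 : 0 < c) (hcK : c < K) (hr : ∀ n, n₀ ≤ n → s (n + 1) ≤ c * s n) {w : ℂ}
    (hw : 0 < w.re) {N : ℕ} (hN : n₀ ≤ N) (hwN : ‖w‖ * (c * (1 - c / K)⁻¹) ≤ K ^ N) :
    (stepSeries s K w).re ≤ 2 * s N := by
  have hd : ∀ n, 0 ≤ s (n + 1) - s n := fun n => sub_nonneg.2 (hs (Nat.le_succ n))
  have hKn : ∀ n : ℕ, 0 < K ^ n := fun n => pow_pos (by linarith) n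
  have H := hasSum_re_stepSeries hs hs0 hK hc0 hcK hr hw
  have hS := summable_increment_div_pow hs hs0 hK hc0 hcK hr
  rw [← H.tsum_eq, ← H.summable.sum_add_tsum_nat_add N, two_mul]
  refine add_le_add ?_ ?_
  · calc _ ≤ ∑ n ∈ Finset.range N, (s (n + 1) - s n) :=
          Finset.sum_le_sum fun n _ =>
            mul_le_of_le_one_right (hd n) (re_div_add_ofReal_le_one hw (hKn n))
      _ = s N := by rw [Finset.sum_range_sub, hz, sub_zero]
  · calc _ ≤ ∑' i, ‖w‖ * ((s (i + N + 1) - s (i + N)) / K ^ (i + N)) := by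
          refine Summable.tsum_le_tsum (fun i => ?_) ((summable_nat_add_iff N).2 H.summable)
            (((summable_nat_add_iff N).2 hS).mul_left _)
          refine le_trans ?_ (norm_stepSeries_term_le hs hK hw (i + N))
          rw [← Complex.re_ofReal_mul]
          exact Complex.re_le_norm _
      _ ≤ ‖w‖ * (s N * c / K ^ N * (1 - c / K)⁻¹) := by
          rw [tsum_mul_left]
          gcongr
          exact tsum_increment_div_pow_le hs hs0 hK hc0 hcK hr hN
      _ = s N * (‖w‖ * (c * (1 - c / K)⁻¹) / K ^ N) := by ring
      _ ≤ s N := mul_le_of_le_one_right (hs0 N) ((div_le_one (hKn N)).2 hwN)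

lemma differentiableAt_stepSeries (hs : Monotone s) (hs0 : ∀ n, 0 ≤ s n) (hK : 1 < K)
    (hc0 : 0 < c) (hcK : c < K) (hr : ∀ n, n₀ ≤ n → s (n + 1) ≤ c * s n) {w : ℂ}
    (hw : 0 < w.re) : DifferentiableAt ℂ (stepSeries s K) w := by
  set U : Set ℂ := {z | 0 < z.re} ∩ Metric.ball 0 (‖w‖ + 1)
  have hU : IsOpen U := (isOpen_lt continuous_const Complex.continuous_re).inter Metric.isOpen_ball
  have hwU : w ∈ U := ⟨hw, by simp⟩
  refine DifferentiableOn.differentiableAt (s := U) ?_ (hU.mem_nhds hwU)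
  refine Complex.differentiableOn_tsum_of_summable_norm
    ((summable_increment_div_pow hs hs0 hK hc0 hcK hr).mul_left (‖w‖ + 1)) (fun n => ?_) hU
    (fun n z hz => ?_)
  · intro z hz
    have hne : z + ((K ^ n : ℝ) : ℂ) ≠ 0 := norm_pos_iff.1
      (lt_of_lt_of_le (pow_pos (by linarith) n)
        (le_norm_add_ofReal hz.1))
    have hden : DifferentiableAt ℂ (fun y : ℂ => y + ((K ^ n : ℝ) : ℂ)) z :=
      differentiableAt_id.add_const _
    exact ((differentiableAt_id.fun_div hden hne).const_mul _).differentiableWithinAt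
  · refine (norm_stepSeries_term_le hs hK hz.1 n).trans ?_
    have hz2 : ‖z‖ < ‖w‖ + 1 := by simpa using hz.2
    exact mul_le_mul_of_nonneg_right hz2.le
      (div_nonneg (sub_nonneg.2 (hs (Nat.le_succ n))) (pow_pos (by linarith) n).le)

end StepSeries

/-- The conformal map `ξ ↦ ξ^{-1/γ}` from `S_γ` to the right half-plane. -/
noncomputable def sectorToHalfPlane (γ : ℝ) (ξ : ℂ) : ℂ :=
  Complex.exp (((-(1 / γ) : ℝ) : ℂ) * Complex.log ξ)

lemma sectorToHalfPlane_re_pos {γ : ℝ} (hγ : 0 < γ) {ξ : ℂ} (hξ : ξ ∈ sector γ) :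
    0 < (sectorToHalfPlane γ ξ).re := by
  rw [sectorToHalfPlane, Complex.exp_re, Complex.im_ofReal_mul, Complex.log_im]
  refine mul_pos (Real.exp_pos _) (Real.cos_pos_of_mem_Ioo ?_)
  have h := abs_lt.1 hξ.2
  have e : -(1 / γ) * ξ.arg = -(ξ.arg / γ) := by ring
  have h1 : ξ.arg / γ < Real.pi / 2 := by
    rw [div_lt_iff₀ hγ]
    linarith
  have h2 : -(Real.pi / 2) < ξ.arg / γ := by
    rw [lt_div_iff₀ hγ]
    linarith
  rw [e]
  constructor <;> linarith

lemma norm_sectorToHalfPlane {γ : ℝ} {ξ : ℂ} (hξ : ξ ≠ 0) :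
    ‖sectorToHalfPlane γ ξ‖ = ‖ξ‖ ^ (-(1 / γ)) := by
  rw [sectorToHalfPlane, Complex.norm_exp, Complex.re_ofReal_mul, Complex.log_re,
    Real.rpow_def_of_pos (norm_pos_iff.2 hξ), mul_comm]

lemma differentiableAt_sectorToHalfPlane {γ : ℝ} (hγ2 : γ < 2) {ξ : ℂ} (hξ : ξ ∈ sector γ) :
    DifferentiableAt ℂ (sectorToHalfPlane γ) ξ := by
  have hs : ξ ∈ Complex.slitPlane := by
    rw [Complex.mem_slitPlane_iff_arg]
    refine ⟨fun h => ?_, hξ.1⟩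
    have := hξ.2
    rw [h, abs_of_pos Real.pi_pos] at this
    nlinarith [Real.pi_pos]
  unfold sectorToHalfPlane
  exact ((Complex.differentiableAt_log hs).const_mul _).cexp

lemma exists_closedBall_subset_sector {γ γ' : ℝ} (h : γ < γ') (h2 : γ' < 2) :
    ∃ ε : ℝ, 0 < ε ∧ ∀ ξ ∈ sector γ, Metric.closedBall ξ (ε * ‖ξ‖) ⊆ sector γ' := by
  have hπ := Real.pi_pos
  have hcont : ContinuousAt Complex.arg 1 := Complex.continuousAt_arg Complex.one_mem_slitPlane
  have hpos : 0 < (γ' - γ) * Real.pi / 2 := by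
    have : 0 < γ' - γ := by linarith
    positivity
  obtain ⟨δ, hδ, hball⟩ := Metric.continuousAt_iff.1 hcont _ hpos
  refine ⟨min (δ / 2) (1 / 2), by positivity, fun ξ hξ z hz => ?_⟩
  have hξ0 : 0 < ‖ξ‖ := norm_pos_iff.2 hξ.1
  have hu : ‖z / ξ - 1‖ ≤ min (δ / 2) (1 / 2) := by
    rw [Metric.mem_closedBall, dist_eq_norm] at hz
    rw [div_sub_one hξ.1, norm_div, div_le_iff₀ hξ0]
    exact hz
  have hz0 : z ≠ 0 := by
    rintro rfl
    have := hu.trans (min_le_right _ _)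
    norm_num at this
  have harg : |(z / ξ).arg| < (γ' - γ) * Real.pi / 2 := by
    have := hball (x := z / ξ) (by
      rw [dist_eq_norm]
      linarith [hu.trans (min_le_left _ _)])
    simpa [Real.dist_eq] using this
  have hlt : |ξ.arg + (z / ξ).arg| < γ' * Real.pi / 2 := by
    refine (abs_add_le _ _).trans_lt ?_
    linarith [hξ.2]
  have hmul : ξ.arg + (z / ξ).arg = z.arg := by
    have hm := Complex.arg_mul (x := ξ) (y := z / ξ) hξ.1 (div_ne_zero hz0 hξ.1) (by
      have := abs_lt.1 hlt
      constructor <;> nlinarith)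
    rw [← hm, mul_div_cancel₀ _ hξ.1]
  exact ⟨hz0, hmul ▸ hlt⟩

/-- Cauchy estimates turn a flat upper bound on a larger sector into membership in the
ultraholomorphic class of the weight matrix. -/
lemma norm_iteratedDeriv_le_of_flat {ω : ℝ → ℝ} (hω : InW0 ω) (h5 : Omega5 ω) {γ γ' : ℝ}
    (h : γ < γ') (h2 : γ' < 2) {a q : ℝ} (ha : 0 < a) (hq : 0 < q) {G : ℂ → ℂ}
    (hG : DifferentiableOn ℂ G (sector γ'))
    (hb : ∀ ξ ∈ sector γ', ‖G ξ‖ ≤ Real.exp (-(a / 2) * upperConj ω (q * ‖ξ‖))) :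
    ∃ h : ℝ, 0 < h ∧ ∃ C : ℝ, ∀ ξ ∈ sector γ, ∀ j : ℕ,
      ‖iteratedDeriv j G ξ‖ ≤ C * h ^ j * Wseq ω (2 / a) j := by
  obtain ⟨ε, hε, hball⟩ := exists_closedBall_subset_sector h h2
  set B : ℝ := Real.exp (a / 2 * (q * (1 + ε))) with hB
  have hB1 : 1 ≤ B := Real.one_le_exp (by positivity)
  refine ⟨B / ε, by positivity, 1, fun ξ hξ j => ?_⟩
  have hr : 0 < ‖ξ‖ := norm_pos_iff.2 hξ.1
  set r := ‖ξ‖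
  have hcauchy := Complex.norm_iteratedDeriv_le_of_forall_mem_sphere_norm_le (f := G) (c := ξ)
    (C := Real.exp (-(a / 2) * upperConj ω (q * ((1 + ε) * r)))) j
    (by positivity : 0 < ε * r)
    (hG.mono (Metric.closure_ball_subset_closedBall.trans (hball ξ hξ))).diffContOnCl
    (fun z hz => by
      have hz' := hball ξ hξ (Metric.sphere_subset_closedBall hz)
      refine (hb z hz').trans (Real.exp_le_exp.2 ?_)
      have hzr : ‖z‖ ≤ (1 + ε) * r := by
        rw [mem_sphere_iff_norm] at hz
        linarith [norm_sub_norm_le z ξ]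
      have := upperConj_anti hω.1 h5 (mul_pos hq (norm_pos_iff.2 hz'.1))
        (mul_le_mul_of_nonneg_left hzr hq.le)
      nlinarith)
  have hcore : (j.factorial : ℝ) * Real.exp (-(a / 2) * upperConj ω (q * ((1 + ε) * r))) / r ^ j
      ≤ B ^ j * Wseq ω (2 / a) j := by
    have hfact : (j.factorial : ℝ) ≤ (j : ℝ) ^ j := by exact_mod_cast Nat.factorial_le_pow j
    have hpos : 0 < q * ((1 + ε) * r) := by positivity
    rcases le_or_gt r j with hrj | hrj
    · have ht : 1 ≤ (j : ℝ) / r := (one_le_div hr).2 hrj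
      have hle := le_upperConj hω.1 h5 hpos (by linarith : 0 ≤ (j : ℝ) / r)
      have hW := pow_mul_exp_le_Wseq hω (by positivity : 0 < 2 / a) ht j
      calc _ ≤ (j : ℝ) ^ j * Real.exp (-(a / 2) * (ω (j / r) - q * ((1 + ε) * r) * (j / r)))
              / r ^ j := by
            gcongr ?_ * Real.exp ?_ / _
            nlinarith
        _ = B ^ j * (((j : ℝ) / r) ^ j * Real.exp (-(ω (j / r) / (2 / a)))) := by
            have he : -(a / 2) * (ω (j / r) - q * ((1 + ε) * r) * (j / r)) =
                j * (a / 2 * (q * (1 + ε))) + -(ω (j / r) / (2 / a)) := by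
              field_simp
              ring
            rw [hB, ← Real.exp_nat_mul, div_pow, he, Real.exp_add]
            ring
        _ ≤ _ := by gcongr
    · have hW := pow_mul_exp_le_Wseq hω (by positivity : 0 < 2 / a) le_rfl j
      rw [hω.2.1 1 ⟨zero_le_one, le_rfl⟩] at hW
      simp only [one_pow, zero_div, neg_zero, Real.exp_zero, mul_one] at hW
      have he : Real.exp (-(a / 2) * upperConj ω (q * ((1 + ε) * r))) ≤ 1 := by
        rw [Real.exp_le_one_iff]
        have := upperConj_nonneg hω.1 h5 hpos
        nlinarith
      calc _ ≤ (r ^ j * 1) / r ^ j := by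
            gcongr
            exact hfact.trans (by gcongr)
        _ = 1 := by rw [mul_one, div_self (by positivity)]
        _ ≤ B ^ j * Wseq ω (2 / a) j := by
            nlinarith [one_le_pow₀ hB1 (n := j)]
  calc _ ≤ _ := hcauchy
    _ = ((j.factorial : ℝ) * Real.exp (-(a / 2) * upperConj ω (q * ((1 + ε) * r))) / r ^ j)
        / ε ^ j := by
      rw [mul_pow]
      field_simp
    _ ≤ (B ^ j * Wseq ω (2 / a) j) / ε ^ j := by gcongr
    _ = _ := by
      rw [div_pow]
      ring

/-- Along a geometric sequence, a condition `(P)` for `(ω⋆)^ι` is a ratio bound. -/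
lemma upperConj_geometric_ratio {ω : ℝ → ℝ} (hω : IsWeightFunction ω) (h5 : Omega5 ω)
    {γ γ' q : ℝ} (hγ0 : 0 < γ) (hγ : γ ≤ γ') (hq : 0 < q) (hP : Pcond (upperConjIota ω) γ') :
    ∃ K c : ℝ, 1 < K ∧ 0 < c ∧ c < K ∧ ∃ n₀ : ℕ, ∀ n, n₀ ≤ n →
      upperConj ω (q / (K ^ γ) ^ (n + 1)) ≤ c * upperConj ω (q / (K ^ γ) ^ n) := by
  obtain ⟨K, hK, c, hcK, hev⟩ := hP
  refine ⟨K, max c 1, hK, by positivity, max_lt hcK hK, ?_⟩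
  have hρ : 1 < K ^ γ := Real.one_lt_rpow hK hγ0
  have hlim : Tendsto (fun n : ℕ => (K ^ γ) ^ n / q) atTop atTop :=
    (tendsto_pow_atTop_atTop_of_one_lt hρ).atTop_div_const hq
  obtain ⟨n₀, hn₀⟩ := (hlim.eventually
    (hev.and (eventually_upperConjIota_pos hω h5))).exists_forall_of_atTop
  refine ⟨n₀, fun n hn => ?_⟩
  obtain ⟨h1, hpos⟩ := hn₀ n hn
  have hρ0 : 0 < K ^ γ := by linarith
  have hρ' : 0 < K ^ γ' := Real.rpow_pos_of_pos (by linarith) _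
  rw [div_le_iff₀ hpos] at h1
  have ht : 0 < (K ^ γ) ^ n / q := by positivity
  have e1 : upperConjIota ω ((K ^ γ) ^ n / q) = upperConj ω (q / (K ^ γ) ^ n) := by
    rw [upperConjIota, if_neg ht.ne', one_div_div]
  have e2 : upperConjIota ω (K ^ γ' * ((K ^ γ) ^ n / q)) =
      upperConj ω (1 / (K ^ γ' * ((K ^ γ) ^ n / q))) := by
    rw [upperConjIota, if_neg (by positivity)]
  rw [e1, e2] at h1
  rw [e1] at hpos
  calc _ ≤ upperConj ω (1 / (K ^ γ' * ((K ^ γ) ^ n / q))) := by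
        refine upperConj_anti hω h5 (by positivity) ?_
        calc 1 / (K ^ γ' * ((K ^ γ) ^ n / q)) ≤ 1 / (K ^ γ * ((K ^ γ) ^ n / q)) := by
              gcongr
              exact hK.le
          _ = _ := by
              rw [pow_succ]
              field_simp
    _ ≤ c * upperConj ω (q / (K ^ γ) ^ n) := h1
    _ ≤ _ := by
        gcongr
        exact le_max_left _ _

/-- A holomorphic function on `S_γ` whose real part is comparable to `ω⋆`. -/
lemma exists_holomorphic_re_comparable {ω : ℝ → ℝ} (hω : InW0 ω) (h5 : Omega5 ω) {γ γ' : ℝ}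
    (hγ0 : 0 < γ) (hγ2 : γ < 2) (hγ : γ ≤ γ') (hP : Pcond (upperConjIota ω) γ') :
    ∃ A K₂ K₃ : ℝ, 0 < K₂ ∧ 0 < K₃ ∧ ∃ H : ℂ → ℂ, DifferentiableOn ℂ H (sector γ) ∧
      ∀ ξ ∈ sector γ, upperConj ω (K₃ * ‖ξ‖) / 2 ≤ (H ξ).re ∧
        (H ξ).re ≤ A + 2 * upperConj ω (K₂ * ‖ξ‖) := by
  have hw := hω.1
  obtain ⟨q, hq, hq0⟩ := exists_upperConj_eq_zero hω h5
  obtain ⟨K, c, hK, hc0, hcK, n₀, hr⟩ := upperConj_geometric_ratio hw h5 hγ0 hγ hq hP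
  set ρ := K ^ γ with hρ_def
  have hρ : 1 < ρ := Real.one_lt_rpow hK hγ0
  have hρ0 : 0 < ρ := by linarith
  have hK0 : 0 < K := by linarith
  set s : ℕ → ℝ := fun n => upperConj ω (q / ρ ^ n) with hs_def
  have hs : Monotone s := fun m n hmn => upperConj_anti hw h5 (by positivity)
    (div_le_div_of_nonneg_left hq.le (by positivity) (pow_le_pow_right₀ hρ.le hmn))
  have hs0 : ∀ n, 0 ≤ s n := fun n => upperConj_nonneg hw h5 (by positivity)
  have hz : s 0 = 0 := by simpa [hs_def] using hq0
  obtain ⟨M, hM⟩ := pow_unbounded_of_one_lt (c * (1 - c / K)⁻¹) hK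
  have hD : 0 ≤ c * (1 - c / K)⁻¹ := by
    have : c / K < 1 := (div_lt_one hK0).2 hcK
    have : 0 < 1 - c / K := by linarith
    positivity
  refine ⟨2 * s (n₀ + M), q / ρ ^ (n₀ + M + 1), q, by positivity, hq,
    fun ξ => stepSeries s K (sectorToHalfPlane γ ξ), fun ξ hξ => ?_, fun ξ hξ => ?_⟩
  · exact ((differentiableAt_stepSeries hs hs0 hK hc0 hcK hr
      (sectorToHalfPlane_re_pos hγ0 hξ)).comp ξ
      (differentiableAt_sectorToHalfPlane hγ2 hξ)).differentiableWithinAt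
  · set w := sectorToHalfPlane γ ξ
    have hwre : 0 < w.re := sectorToHalfPlane_re_pos hγ0 hξ
    have hξ0 : 0 < ‖ξ‖ := norm_pos_iff.2 hξ.1
    have hnorm : ‖ξ‖ = (‖w‖ ^ γ)⁻¹ := by
      rw [norm_sectorToHalfPlane hξ.1, ← Real.rpow_mul hξ0.le, ← Real.rpow_neg hξ0.le]
      field_simp
      simp
    have hw0 : 0 < ‖w‖ := hwre.trans_le (Complex.re_le_norm w)
    have hpow : ∀ n : ℕ, ρ ^ n = (K ^ n) ^ γ := fun n => by
      rw [hρ_def, ← Real.rpow_natCast, ← Real.rpow_natCast, ← Real.rpow_mul hK0.le,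
        ← Real.rpow_mul hK0.le, mul_comm]
    rcases lt_or_ge ‖w‖ 1 with h1 | h1
    · have hξ1 : 1 ≤ ‖ξ‖ := by
        rw [hnorm]
        exact (one_le_inv₀ (by positivity)).2 (Real.rpow_le_one hw0.le h1.le hγ0.le)
      constructor
      · have : upperConj ω (q * ‖ξ‖) ≤ 0 := hq0 ▸
          upperConj_anti hw h5 hq (le_mul_of_one_le_right hq.le hξ1)
        linarith [re_stepSeries_nonneg hs hs0 hK hc0 hcK hr hwre]
      · have := re_stepSeries_le hs hs0 hz hK hc0 hcK hr hwre (Nat.le_add_right n₀ M) (by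
          calc _ ≤ 1 * K ^ M := by gcongr
            _ ≤ K ^ (n₀ + M) := by
              rw [one_mul]
              exact pow_le_pow_right₀ hK.le (by omega))
        have h3 := upperConj_nonneg hw h5
          (by positivity : 0 < q / ρ ^ (n₀ + M + 1) * ‖ξ‖)
        linarith
    · obtain ⟨m, hm1, hm2⟩ := exists_nat_pow_near h1 hK
      constructor
      · refine le_trans ?_ (half_le_re_stepSeries hs hs0 hz hK hc0 hcK hr hwre hm1)
        have : upperConj ω (q * ‖ξ‖) ≤ s (m + 1) := by
          refine upperConj_anti hw h5 (by positivity) ?_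
          rw [hnorm, hpow, ← div_eq_mul_inv]
          gcongr
        linarith
      · have := re_stepSeries_le hs hs0 hz hK hc0 hcK hr hwre
          (by omega : n₀ ≤ n₀ + M + 1 + m) (by
          calc _ ≤ K ^ (m + 1) * K ^ M := by gcongr
            _ ≤ K ^ (n₀ + M + 1 + m) := by
              rw [← pow_add]
              exact pow_le_pow_right₀ hK.le (by omega))
        have h3 : s (n₀ + M + 1 + m) ≤ upperConj ω (q / ρ ^ (n₀ + M + 1) * ‖ξ‖) := by
          refine upperConj_anti hw h5 (by positivity) ?_
          rw [pow_add _ _ m, ← div_div, div_eq_mul_inv _ (ρ ^ m), hnorm, hpow m]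
          gcongr
        linarith [hs0 (n₀ + M)]

/-- Theorem 2.3.1 analogue: existence of optimal sectorially flat
functions `G_a ∈ A_{{W^{y(a)}}}(S_γ) ⊆ A_{{ω}}(S_γ)` with two-sided bounds. -/
theorem optimal_flat_functions
    (ω : ℝ → ℝ) (hω : InW0 ω) (h1 : Omega1 ω) (h5 : Omega5 ω)
    (hγι : 0 < gammaIndex (upperConjIota ω))
    (γ : ℝ) (hγ0 : 0 < γ)
    (hγ : ENNReal.ofReal γ < min 2 (gammaIndex (upperConjIota ω))) :
    ∃ K₁ K₂ K₃ : ℝ, 0 < K₁ ∧ 0 < K₂ ∧ 0 < K₃ ∧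
      ∀ a : ℝ, 0 < a → ∃ y : ℝ, 0 < y ∧ ∃ G : ℂ → ℂ,
        DifferentiableOn ℂ G (sector γ) ∧
        (∀ ξ ∈ sector γ,
          K₁ ^ (-a) * Real.exp (-(2 * a) * upperConj ω (K₂ * ‖ξ‖)) ≤ ‖G ξ‖ ∧
          ‖G ξ‖ ≤ Real.exp (-(a / 2) * upperConj ω (K₃ * ‖ξ‖))) ∧
        (∃ h : ℝ, 0 < h ∧ ∃ C : ℝ, ∀ ξ ∈ sector γ, ∀ j : ℕ,
          ‖iteratedDeriv j G ξ‖ ≤ C * h ^ j * Wseq ω y j) := by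
  obtain ⟨hγ2, hγi⟩ := lt_min_iff.1 hγ
  replace hγ2 : γ < 2 := by
    by_contra hcon
    have h' := ENNReal.ofReal_le_ofReal (not_lt.1 hcon)
    rw [ENNReal.ofReal_ofNat] at h'
    exact absurd hγ2 (not_lt.2 h')
  obtain ⟨γ₁, ⟨hγ₁0, hP⟩, hγ₁⟩ : ∃ γ₁, (0 < γ₁ ∧ Pcond (upperConjIota ω) γ₁) ∧ γ < γ₁ := by
    obtain ⟨γ₁, h⟩ := lt_iSup_iff.1 hγi
    obtain ⟨hmem, h⟩ := lt_iSup_iff.1 h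
    exact ⟨γ₁, hmem, (ENNReal.ofReal_lt_ofReal_iff hmem.1).1 h⟩
  obtain ⟨γ', hγγ', hγ'⟩ := exists_between (lt_min hγ2 hγ₁)
  obtain ⟨hγ'2, hγ'1⟩ := lt_min_iff.1 hγ'
  obtain ⟨A, K₂, K₃, hK₂, hK₃, H, hH, hbound⟩ := exists_holomorphic_re_comparable hω h5
    (hγ0.trans hγγ') hγ'2 hγ'1.le hP
  refine ⟨Real.exp A, K₂, K₃, Real.exp_pos A, hK₂, hK₃, fun a ha => ⟨2 / a, by positivity,
    fun ξ => Complex.exp (-(a : ℂ) * H ξ), ?_⟩⟩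
  have hG : DifferentiableOn ℂ (fun ξ => Complex.exp (-(a : ℂ) * H ξ)) (sector γ') :=
    (hH.const_mul _).cexp
  have hnorm : ∀ ξ, ‖Complex.exp (-(a : ℂ) * H ξ)‖ = Real.exp (-a * (H ξ).re) := fun ξ => by
    rw [Complex.norm_exp, ← Complex.ofReal_neg, Complex.re_ofReal_mul]
  have hupper : ∀ ξ ∈ sector γ', ‖Complex.exp (-(a : ℂ) * H ξ)‖ ≤
      Real.exp (-(a / 2) * upperConj ω (K₃ * ‖ξ‖)) := fun ξ hξ => by
    rw [hnorm]
    apply Real.exp_le_exp.2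
    nlinarith [(hbound ξ hξ).1]
  have hsub : sector γ ⊆ sector γ' := fun ξ hξ =>
    ⟨hξ.1, hξ.2.trans (by nlinarith [Real.pi_pos])⟩
  refine ⟨hG.mono hsub, fun ξ hξ => ⟨?_, hupper ξ (hsub hξ)⟩,
    norm_iteratedDeriv_le_of_flat hω h5 hγγ' hγ'2 ha hK₃ hG hupper⟩
  rw [hnorm, ← Real.exp_mul, ← Real.exp_add]
  apply Real.exp_le_exp.2
  nlinarith [(hbound ξ (hsub hξ)).2]
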